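/- arXiv:2603.10932 — 4 statements merged into one kernel-verified Lean document; each statement's English description precedes it below -/
import Mathlib

section
/- Let n be a positive integer and let A be a symmetric n×n matrix over the field 𝔽₂ = ZMod 2. Then there exist a diagonal n×n matrix Λ over 𝔽₂ and a lower-triangular n×n matrix M over 𝔽₂ with all diagonal entries equal to 1 (hence M is invertible) such that A + Λ = M * Mᵀ. -/
open Matrix

theorem aux_factor (n : ℕ) : ∀ (A : Matrix (Fin n) (Fin n) (ZMod 2)), (∀ i j, A i j = A j i) →
    ∃ M : Matrix (Fin n) (Fin n) (ZMod 2), (∀ i, M i i = 1) ∧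
      (∀ i j : Fin n, i < j → M i j = 0) ∧
      ∀ i j, i ≠ j → A i j = ∑ k, M i k * M j k := by
  induction n with
  | zero => exact fun A _ => ⟨A, fun i => i.elim0, fun i => i.elim0, fun i => i.elim0⟩
  | succ n ih =>
    intro A hA
    obtain ⟨M, h1, h2, h3⟩ := ih (fun i j => A i.succ j.succ - A i.succ 0 * A j.succ 0)
      (fun i j => by simp only [hA i.succ j.succ]; ring)
    refine ⟨fun i j => Fin.cases (Fin.cases 1 (fun _ => 0) j)
      (fun i' => Fin.cases (A i'.succ 0) (M i') j) i, ?_, ?_, ?_⟩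
    · intro i
      cases i using Fin.cases with
      | zero => simp
      | succ i => simpa using h1 i
    · intro i j hij
      cases i using Fin.cases with
      | zero =>
        cases j using Fin.cases with
        | zero => simp at hij
        | succ j => simp
      | succ i =>
        cases j using Fin.cases with
        | zero => simp at hij
        | succ j => simpa using h2 i j (by simpa using hij)
    · intro i j hij
      rw [Fin.sum_univ_succ]
      cases i using Fin.cases with
      | zero =>
        cases j using Fin.cases with
        | zero => simp at hij
        | succ j => simp [hA 0 j.succ]
      | succ i =>
        cases j using Fin.cases with
        | zero => simp
        | succ j =>
          have h := h3 i j (by simpa using hij)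
          simp only [Fin.cases_zero, Fin.cases_succ]
          rw [← h]; ring

theorem symm_eq_lowerTriangular_mul_transpose_add_diagonal
    (n : ℕ) (hn : 0 < n) (A : Matrix (Fin n) (Fin n) (ZMod 2)) (hA : A.IsSymm) :
    ∃ (Λ M : Matrix (Fin n) (Fin n) (ZMod 2)),
      Λ.IsDiag ∧
      (∀ i, M i i = 1) ∧
      (∀ i j : Fin n, i < j → M i j = 0) ∧
      IsUnit M ∧
      A + Λ = M * Mᵀ := by
  obtain ⟨M, h1, h2, h3⟩ := aux_factor n A (fun i j => hA.apply j i)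
  refine ⟨M * Mᵀ - A, M, ?_, h1, h2, ?_, by abel⟩
  · intro i j hij
    simp [Matrix.mul_apply, h3 i j hij]
  · rw [Matrix.isUnit_iff_isUnit_det, Matrix.det_of_lowerTriangular M (fun i j h => h2 i j h)]
    simp [h1]
end

section
/- Let d and S be positive integers and let P₁, …, P_S be d×d complex matrices that pairwise commute, satisfy Pᵢ * Pᵢ = 1 for every i, and are such that for every nonempty subset T of {1, …, S} the product ∏_{i ∈ T} Pᵢ has trace 0. Then the simultaneous +1-eigenspace ⋂_{i=1}^{S} ker(Pᵢ - 1) has dimension exactly d / 2^S (in particular 2^S divides d). -/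
open Matrix

theorem stabilizer_subspace_dim
    (d S : ℕ) (hd : 0 < d) (hS : 0 < S)
    (P : Fin S → Matrix (Fin d) (Fin d) ℂ)
    (hcomm : ∀ i j, Commute (P i) (P j))
    (hinv : ∀ i, P i * P i = 1)
    (htr : ∀ T : Finset (Fin S), T.Nonempty →
      (T.noncommProd P (fun a _ b _ _ => hcomm a b)).trace = 0) :
    (2 ^ S ∣ d) ∧
      Module.finrank ℂ ↥(⨅ i, LinearMap.ker (Matrix.mulVecLin (P i - 1))) = d / 2 ^ S := by
  classical
  let f : Finset (Fin S) → Matrix (Fin d) (Fin d) ℂ :=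
    fun T => T.noncommProd P (fun a _ b _ _ => hcomm a b)
  have hf0 : f ∅ = 1 := Finset.noncommProd_empty _ _
  have hins : ∀ T i, i ∉ T → f (insert i T) = P i * f T := fun T i hi =>
    Finset.noncommProd_insert_of_notMem T i P _ hi
  let g : Fin S → Finset (Fin S) → Finset (Fin S) :=
    fun i T => if i ∈ T then T.erase i else insert i T
  have hgg : ∀ i T, g i (g i T) = T := by
    intro i T
    by_cases h : i ∈ T <;> simp [g, h]
  have hmul : ∀ i T, P i * f T = f (g i T) := by
    intro i T
    by_cases h : i ∈ T
    · have h1 := hins (T.erase i) i (Finset.notMem_erase i T)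
      rw [Finset.insert_erase h] at h1
      simp only [g, h, if_true]
      rw [h1, ← mul_assoc, hinv, one_mul]
    · simp only [g, h, if_false]
      rw [hins T i h]
  let M : Matrix (Fin d) (Fin d) ℂ := ∑ T : Finset (Fin S), f T
  have hPM : ∀ i, P i * M = M := by
    intro i
    simp only [M, Finset.mul_sum, hmul]
    exact Equiv.sum_comp (Function.Involutive.toPerm (g i) (hgg i)) f
  have htrM : M.trace = d := by
    simp only [M, Matrix.trace_sum]
    rw [Finset.sum_eq_single ∅]
    · rw [hf0]; simp
    · intro T _ hT
      exact htr T (Finset.nonempty_iff_ne_empty.mpr hT)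
    · simp
  set V := ⨅ i, LinearMap.ker (Matrix.mulVecLin (P i - 1)) with hV
  have hmem : ∀ x, x ∈ V ↔ ∀ i, P i *ᵥ x = x := by
    intro x
    simp [hV, Submodule.mem_iInf, sub_eq_zero]
  have hfx : ∀ x ∈ V, ∀ T, f T *ᵥ x = x := by
    intro x hx T
    induction T using Finset.induction_on with
    | empty => rw [hf0, Matrix.one_mulVec]
    | insert i T hi ih =>
      rw [hins T i hi, ← Matrix.mulVec_mulVec, ih, (hmem x).1 hx i]
  have h2 : (2 ^ S : ℂ) ≠ 0 := pow_ne_zero _ two_ne_zero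
  have hproj : LinearMap.IsProj V (Matrix.toLin' ((2 ^ S : ℂ)⁻¹ • M)) := by
    constructor
    · intro x
      rw [hmem]
      intro i
      rw [Matrix.toLin'_apply, Matrix.mulVec_mulVec, Matrix.mul_smul, hPM]
    · intro x hx
      rw [Matrix.toLin'_apply, Matrix.smul_mulVec]
      simp only [M, Matrix.sum_mulVec, hfx x hx]
      rw [Finset.sum_const, Finset.card_univ, Fintype.card_finset, Fintype.card_fin,
        ← Nat.cast_smul_eq_nsmul ℂ, smul_smul]
      push_cast
      rw [inv_mul_cancel₀ h2, one_smul]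
  have ht := hproj.trace
  rw [Matrix.trace_toLin'_eq, Matrix.trace_smul, htrM, smul_eq_mul] at ht
  have hfin : d = 2 ^ S * Module.finrank ℂ V := by
    have : (d : ℂ) = 2 ^ S * Module.finrank ℂ V := by
      rw [← ht, mul_inv_cancel_left₀ h2]
    exact_mod_cast this
  refine ⟨⟨_, hfin⟩, ?_⟩
  exact (Nat.div_eq_of_eq_mul_right (by positivity) hfin).symm
end

section
/- Fix L ≥ 2 and real parameters a > 0, g, m. On the register of N_q = 2L − 1 qubits (matter sites n = 1, …, L and link qubits (n, n+1) for n = 1, …, L − 1, operators extended by Kronecker products), with Pauli matrices X = !![0,1;1,0], Y = !![0,-I;I,0], Z = !![1,0;0,-1], define the Hamiltonian H = −(1/(4a)) ∑_{n=1}^{L−1} (X_n * σZ_{n,n+1} * X_{n+1} + Y_n * σZ_{n,n+1} * Y_{n+1}) + a g² ∑_{n=1}^{L−1} (1 − σX_{n,n+1}) + (m/2) ∑_{n=1}^{L} (−1)^n Z_n, and the Gauss's law operators G_n = (−1)^n · σX_{n−1,n} * Z_n * σX_{n,n+1} for 1 ≤ n ≤ L − 1 (with σX_{0,1} the identity). Then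 H commutes with every Gauss's law operator: H * G_n = G_n * H for all 1 ≤ n ≤ L − 1. -/
/-!
STATEMENT 12: the qubit Hamiltonian of the (1+1)-dimensional ℤ₂ lattice gauge theory
coupled to staggered fermions,
`H = −(1/(4a)) ∑_{n=1}^{L−1} (X_n σZ_{n,n+1} X_{n+1} + Y_n σZ_{n,n+1} Y_{n+1})
   + a g² ∑_{n=1}^{L−1} (1 − σX_{n,n+1}) + (m/2) ∑_{n=1}^{L} (−1)^n Z_n`,
commutes with every Gauss's law operator
`G_n = (−1)^n σX_{n−1,n} Z_n σX_{n,n+1}` (with `σX_{0,1} = 1`).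

The register has matter sites `n = 1, …, L` (indexed by `Sum.inl`, 0-based) and link
qubits `(n, n+1)` for `n = 1, …, L − 1` (indexed by `Sum.inr`, 0-based); operators on a
single qubit are extended to the register by Kronecker products with the identity.
-/

open Matrix

namespace Z2LGT

/-- Qubits of the register: `L` matter sites and `L - 1` link qubits. -/
abbrev QubitIdx (L : ℕ) := Fin L ⊕ Fin (L - 1)

/-- The operator acting as the single-qubit operator `A` on qubit `q` of the register and
as the identity on all other qubits (an iterated Kronecker product). -/
noncomputable def opOn {ι : Type} [Fintype ι] [DecidableEq ι]
    (A : Matrix (Fin 2) (Fin 2) ℂ) (q : ι) :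
    Matrix (ι → Fin 2) (ι → Fin 2) ℂ :=
  Matrix.of fun x y => ∏ j, if j = q then A (x j) (y j) else if x j = y j then 1 else 0

/-- Pauli `X`. -/
def PX : Matrix (Fin 2) (Fin 2) ℂ := !![0, 1; 1, 0]

/-- Pauli `Y`. -/
def PY : Matrix (Fin 2) (Fin 2) ℂ := !![0, -Complex.I; Complex.I, 0]

/-- Pauli `Z`. -/
def PZ : Matrix (Fin 2) (Fin 2) ℂ := !![1, 0; 0, -1]

/-- The matter site `n + 1` (1-based) as an element of `Fin L`. -/
def site (L : ℕ) (n : Fin (L - 1)) : Fin L :=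
  ⟨n.val, lt_of_lt_of_le n.isLt (Nat.sub_le _ _)⟩

/-- The matter site `n + 2` (1-based) as an element of `Fin L`. -/
def site' (L : ℕ) (n : Fin (L - 1)) : Fin L :=
  ⟨n.val + 1, Nat.add_lt_of_lt_sub n.isLt⟩

/-- The Gauss's law operator `G_{n+1} = (−1)^{n+1} σX_{n,n+1} Z_{n+1} σX_{n+1,n+2}`
(1-based numbering; `n : Fin (L-1)` is 0-based, and for `n = 0` the boundary operator
`σX_{0,1}` is the identity). -/
noncomputable def gauss (L : ℕ) (n : Fin (L - 1)) :
    Matrix (QubitIdx L → Fin 2) (QubitIdx L → Fin 2) ℂ :=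
  ((-1 : ℂ) ^ (n.val + 1)) •
    ((if n.val = 0 then 1 else
        opOn PX (Sum.inr (⟨n.val - 1, lt_of_le_of_lt (Nat.sub_le _ _) n.isLt⟩ : Fin (L - 1)))) *
      opOn PZ (Sum.inl (site L n)) *
      opOn PX (Sum.inr n))

/-- The qubit Hamiltonian of the ℤ₂ lattice gauge theory coupled to staggered fermions,
with lattice spacing `a`, gauge coupling `g` and fermion mass `m`. -/
noncomputable def ham (L : ℕ) (a g m : ℝ) :
    Matrix (QubitIdx L → Fin 2) (QubitIdx L → Fin 2) ℂ :=
  ((-(1 / (4 * a)) : ℝ) : ℂ) •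
      (∑ n : Fin (L - 1),
        (opOn PX (Sum.inl (site L n)) * opOn PZ (Sum.inr n) * opOn PX (Sum.inl (site' L n)) +
          opOn PY (Sum.inl (site L n)) * opOn PZ (Sum.inr n) * opOn PY (Sum.inl (site' L n))))
    + ((a * g ^ 2 : ℝ) : ℂ) • (∑ n : Fin (L - 1), (1 - opOn PX (Sum.inr n)))
    + ((m / 2 : ℝ) : ℂ) • (∑ n : Fin L, ((-1 : ℂ) ^ (n.val + 1)) • opOn PZ (Sum.inl n))

/-- Kronecker product over all qubits. -/
noncomputable def kron {ι : Type} [Fintype ι] [DecidableEq ι]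
    (f : ι → Matrix (Fin 2) (Fin 2) ℂ) : Matrix (ι → Fin 2) (ι → Fin 2) ℂ :=
  Matrix.of fun x y => ∏ j, f j (x j) (y j)

lemma kron_mul {ι : Type} [Fintype ι] [DecidableEq ι]
    (f g : ι → Matrix (Fin 2) (Fin 2) ℂ) :
    kron f * kron g = kron (fun j => f j * g j) := by
  ext x y
  simp only [kron, Matrix.mul_apply, Matrix.of_apply]
  rw [Finset.prod_univ_sum, Fintype.piFinset_univ]
  simp only [Finset.prod_mul_distrib]

lemma opOn_eq {ι : Type} [Fintype ι] [DecidableEq ι]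
    (A : Matrix (Fin 2) (Fin 2) ℂ) (q : ι) :
    opOn A q = kron (fun j => if j = q then A else 1) := by
  ext x y
  simp only [opOn, kron, Matrix.of_apply]
  refine Finset.prod_congr rfl fun j _ => ?_
  by_cases hj : j = q
  · simp [hj]
  · simp [hj, Matrix.one_apply]

lemma opOn_smul {ι : Type} [Fintype ι] [DecidableEq ι]
    (c : ℂ) (A : Matrix (Fin 2) (Fin 2) ℂ) (q : ι) :
    opOn (c • A) q = c • opOn A q := by
  ext x y
  simp only [opOn, Matrix.of_apply, Matrix.smul_apply, smul_eq_mul]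
  rw [← Finset.mul_prod_erase _ _ (Finset.mem_univ q),
    ← Finset.mul_prod_erase Finset.univ (fun j => if j = q then A (x j) (y j) else _)
      (Finset.mem_univ q)]
  simp only [if_true, mul_assoc]
  congr 2
  refine Finset.prod_congr rfl fun j hj => ?_
  simp [Finset.ne_of_mem_erase hj]

/-- `A` and `B` commute up to the sign `e`. -/
def SC {ι : Type} [Fintype ι] (e : ℂ) (A B : Matrix ι ι ℂ) : Prop := A * B = e • (B * A)

lemma SC.mulR {ι : Type} [Fintype ι] {e f : ℂ} {A B C : Matrix ι ι ℂ}
    (h : SC e A B) (h' : SC f A C) : SC (e * f) A (B * C) := by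
  unfold SC at *
  rw [← mul_assoc, h, smul_mul_assoc, mul_assoc, h', mul_smul_comm, smul_smul, mul_assoc]

lemma SC.mulL {ι : Type} [Fintype ι] {e f : ℂ} {A B C : Matrix ι ι ℂ}
    (h : SC e A C) (h' : SC f B C) : SC (e * f) (A * B) C := by
  unfold SC at *
  rw [mul_assoc, h', mul_smul_comm, ← mul_assoc, h, smul_mul_assoc, smul_smul, mul_assoc,
    mul_comm e f]

lemma SC.commute {ι : Type} [Fintype ι] {e : ℂ} {A B : Matrix ι ι ℂ}
    (h : SC e A B) (he : e = 1) : Commute A B := by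
  unfold SC at h
  rw [he, one_smul] at h
  exact h

lemma sc_ne {ι : Type} [Fintype ι] [DecidableEq ι] (A B : Matrix (Fin 2) (Fin 2) ℂ) {p q : ι}
    (h : p ≠ q) : SC 1 (opOn A p) (opOn B q) := by
  unfold SC
  rw [one_smul, opOn_eq, opOn_eq, kron_mul, kron_mul]
  congr 1
  funext j
  split_ifs <;> simp_all

lemma sc_if {ι : Type} [Fintype ι] [DecidableEq ι] {A B : Matrix (Fin 2) (Fin 2) ℂ} {p q : ι}
    {e : ℂ} (h : A * B = e • (B * A)) : SC (if p = q then e else 1) (opOn A p) (opOn B q) := by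
  split_ifs with hp
  · subst hp
    have key : ∀ C D : Matrix (Fin 2) (Fin 2) ℂ, opOn C p * opOn D p = opOn (C * D) p := by
      intro C D
      rw [opOn_eq, opOn_eq, kron_mul, opOn_eq]
      congr 1
      funext j
      split_ifs <;> simp
    unfold SC
    rw [key, key, h, opOn_smul]
  · exact sc_ne A B hp

lemma opOn_comm_self {ι : Type} [Fintype ι] [DecidableEq ι] (A : Matrix (Fin 2) (Fin 2) ℂ)
    (p q : ι) : Commute (opOn A p) (opOn A q) :=
  (sc_if (e := 1) (by simp)).commute (by simp)

lemma opOn_comm_ne {ι : Type} [Fintype ι] [DecidableEq ι] (A B : Matrix (Fin 2) (Fin 2) ℂ)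
    {p q : ι} (h : p ≠ q) : Commute (opOn A p) (opOn B q) :=
  (sc_ne A B h).commute rfl

lemma PXZ : PX * PZ = (-1 : ℂ) • (PZ * PX) := by
  ext i j; fin_cases i <;> fin_cases j <;> simp [PX, PZ]

lemma PZX : PZ * PX = (-1 : ℂ) • (PX * PZ) := by
  ext i j; fin_cases i <;> fin_cases j <;> simp [PX, PZ]

lemma PZY : PZ * PY = (-1 : ℂ) • (PY * PZ) := by
  ext i j; fin_cases i <;> fin_cases j <;> simp [PY, PZ]

lemma hop_comm (L : ℕ) (n k : Fin (L - 1)) (P : Matrix (Fin 2) (Fin 2) ℂ)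
    (hP : PZ * P = (-1 : ℂ) • (P * PZ)) :
    Commute (gauss L n) (opOn P (Sum.inl (site L k)) * opOn PZ (Sum.inr k) *
      opOn P (Sum.inl (site' L k))) := by
  have hl : ∀ l : Fin (L - 1), SC (if l = k then -1 else 1)
      (opOn PX (Sum.inr l : QubitIdx L)) (opOn P (Sum.inl (site L k)) * opOn PZ (Sum.inr k) *
      opOn P (Sum.inl (site' L k))) := by
    intro l
    have := ((sc_ne PX P (p := (Sum.inr l : QubitIdx L)) (q := Sum.inl (site L k)) (by simp)).mulR
      (sc_if (p := (Sum.inr l : QubitIdx L)) (q := Sum.inr k) PXZ)).mulR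
      (sc_ne PX P (p := (Sum.inr l : QubitIdx L)) (q := Sum.inl (site' L k)) (by simp))
    simpa using this
  have hs : SC ((if n.val = k.val then -1 else 1) * (if n.val = k.val + 1 then -1 else 1))
      (opOn PZ (Sum.inl (site L n) : QubitIdx L))
      (opOn P (Sum.inl (site L k)) * opOn PZ (Sum.inr k) * opOn P (Sum.inl (site' L k))) := by
    have := ((sc_if (p := (Sum.inl (site L n) : QubitIdx L)) (q := Sum.inl (site L k)) hP).mulR
      (sc_ne PZ PZ (p := (Sum.inl (site L n) : QubitIdx L)) (q := Sum.inr k) (by simp))).mulR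
      (sc_if (p := (Sum.inl (site L n) : QubitIdx L)) (q := Sum.inl (site' L k)) hP)
    simpa [site, site'] using this
  unfold gauss
  apply Commute.smul_left
  split_ifs with h0
  · rw [one_mul]
    refine (hs.mulL (hl n)).commute ?_
    simp only [Fin.ext_iff]
    split_ifs <;> first | omega | norm_num
  · refine (((hl _).mulL hs).mulL (hl n)).commute ?_
    simp only [Fin.ext_iff]
    split_ifs <;> first | omega | norm_num

lemma link_comm (L : ℕ) (n k : Fin (L - 1)) :
    Commute (gauss L n) (opOn PX (Sum.inr k)) := by
  unfold gauss
  apply Commute.smul_left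
  refine Commute.mul_left (Commute.mul_left ?_ (opOn_comm_ne _ _ (by simp))) (opOn_comm_self _ _ _)
  split_ifs
  · exact Commute.one_left _
  · exact opOn_comm_self _ _ _

lemma site_comm (L : ℕ) (n : Fin (L - 1)) (k : Fin L) :
    Commute (gauss L n) (opOn PZ (Sum.inl k)) := by
  unfold gauss
  apply Commute.smul_left
  refine Commute.mul_left (Commute.mul_left ?_ (opOn_comm_self _ _ _)) (opOn_comm_ne _ _ (by simp))
  split_ifs
  · exact Commute.one_left _
  · exact opOn_comm_ne _ _ (by simp)

theorem ham_commutes_with_gauss (L : ℕ) (hL : 2 ≤ L) (a g m : ℝ) (ha : 0 < a)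
    (n : Fin (L - 1)) :
    ham L a g m * gauss L n = gauss L n * ham L a g m := by
  have : Commute (gauss L n) (ham L a g m) := by
    unfold ham
    refine Commute.add_right (Commute.add_right ?_ ?_) ?_
    · refine Commute.smul_right (Commute.sum_right _ _ _ fun k _ => ?_) _
      exact (hop_comm L n k PX PZX).add_right (hop_comm L n k PY PZY)
    · refine Commute.smul_right (Commute.sum_right _ _ _ fun k _ => ?_) _
      exact (Commute.one_right _).sub_right (link_comm L n k)
    · refine Commute.smul_right (Commute.sum_right _ _ _ fun k _ => ?_) _
      exact (site_comm L n k).smul_right _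
  exact this.symm.eq

end Z2LGT
end

section
/- Fix a positive integer N and let the Pauli group 𝒫_N be the subgroup of invertible 2^N × 2^N complex matrices generated by the scalar matrix i·1 together with the single-qubit operators X_j and Z_j for j = 1, …, N (the Pauli matrices X = !![0,1;1,0] and Z = !![1,0;0,-1] acting on qubit j and the identity elsewhere, via Kronecker products). Let 𝒢 be a subgroup of 𝒫_N that is commutative, does not contain −1 (the negative of the identity matrix), and has cardinality 2^S for some S ≤ N. Then there exists a unitary 2^N × 2^N matrix W that normalizes the Pauli group (W * P * Wᴴ ∈ 𝒫_N for every P ∈ 𝒫_N) such that conjugation by W carries 𝒢 exactly onto the subgroup generated by {Z_1, …, Z_S}: { W * Gₐ * Wᴴ : Gₐ ∈ 𝒢 } = ⟨Z_1, …, Z_S⟩. -/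
/-!
STATEMENT 14 (Corollary D.4): any commutative subgroup `𝒢` of the `N`-qubit Pauli group
with `−1 ∉ 𝒢` and `|𝒢| = 2^S` (`S ≤ N`) can be conjugated by a Clifford unitary `W`
(a unitary normalizing the Pauli group) exactly onto the subgroup generated by
`Z_1, …, Z_S`.

The Pauli group is realized as the multiplicative closure of `i·1` together with the
single-qubit operators `X_j` and `Z_j` (every generator has finite multiplicative order,
so this closure is a group of invertible matrices); likewise `⟨Z_1, …, Z_S⟩` is the
multiplicative closure of `{Z_j : j < S}`, and the subgroup `𝒢` is a submonoid of
matrices contained in the Pauli group (being finite and consisting of invertible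
matrices, it is automatically closed under inverses).
-/

open Matrix

namespace Z2LGT

/-- The `N`-qubit Pauli group `𝒫_N`: the group of matrices generated by the scalar matrix
`i·1` and the single-qubit Pauli operators `X_j`, `Z_j` for `j = 1, …, N`. -/
noncomputable def PauliGroup (N : ℕ) :
    Submonoid (Matrix (Fin N → Fin 2) (Fin N → Fin 2) ℂ) :=
  Submonoid.closure
    ({Complex.I • (1 : Matrix (Fin N → Fin 2) (Fin N → Fin 2) ℂ)} ∪
      Set.range (fun j : Fin N => opOn PX j) ∪
      Set.range (fun j : Fin N => opOn PZ j))

abbrev Mat (N : ℕ) := Matrix (Fin N → Fin 2) (Fin N → Fin 2) ℂ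

def flp {N : ℕ} (q : Fin N) (y : Fin N → Fin 2) : Fin N → Fin 2 := Function.update y q (1 - y q)

def sgn {N : ℕ} (q : Fin N) (x : Fin N → Fin 2) : ℂ := if x q = 0 then 1 else -1

theorem fin2_cases (a : Fin 2) : a = 0 ∨ a = 1 := by fin_cases a <;> simp

theorem flp_flp {N : ℕ} (q : Fin N) (y : Fin N → Fin 2) : flp q (flp q y) = y := by
  unfold flp; ext j; by_cases h : j = q
  · subst h; simp
  · simp [h]

theorem flp_comm {N : ℕ} (p q : Fin N) (y : Fin N → Fin 2) :
    flp p (flp q y) = flp q (flp p y) := by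
  by_cases h : p = q
  · subst h; rfl
  · unfold flp
    rw [Function.update_of_ne h, Function.update_of_ne (Ne.symm h), Function.update_comm h]

theorem sgn_flp_same {N : ℕ} (q : Fin N) (y : Fin N → Fin 2) : sgn q (flp q y) = - sgn q y := by
  unfold sgn flp
  rcases fin2_cases (y q) with h | h <;> simp [h]

theorem sgn_flp_ne {N : ℕ} {p q : Fin N} (h : p ≠ q) (y : Fin N → Fin 2) :
    sgn q (flp p y) = sgn q y := by
  unfold sgn flp
  rw [Function.update_of_ne (Ne.symm h)]

theorem sgn_sq {N : ℕ} (q : Fin N) (y : Fin N → Fin 2) : sgn q y * sgn q y = 1 := by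
  unfold sgn; split_ifs <;> simp

theorem sgn_star {N : ℕ} (q : Fin N) (y : Fin N → Fin 2) : star (sgn q y) = sgn q y := by
  unfold sgn; split_ifs <;> simp

theorem opZ {N : ℕ} (q : Fin N) : opOn PZ q = (Matrix.diagonal (sgn q) : Mat N) := by
  ext x y
  by_cases h : x = y
  · subst h
    simp only [opOn, Matrix.of_apply, Matrix.diagonal_apply_eq, if_true]
    rw [Finset.prod_ite_eq' Finset.univ q (fun j => PZ (x j) (x j))]
    rcases fin2_cases (x q) with h | h <;> simp [h, PZ, sgn]
  · rw [Matrix.diagonal_apply_ne _ h]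
    obtain ⟨j, hj⟩ := Function.ne_iff.mp h
    simp only [opOn, Matrix.of_apply]
    apply Finset.prod_eq_zero (Finset.mem_univ j)
    by_cases hq : j = q
    · subst hq
      rw [if_pos rfl]
      rcases fin2_cases (x j) with h | h <;> rcases fin2_cases (y j) with h' | h' <;>
        simp_all [PZ]
    · simp [hq, hj]

theorem opX {N : ℕ} (q : Fin N) :
    opOn PX q = (Matrix.of fun x y => if x = flp q y then 1 else 0 : Mat N) := by
  ext x y
  simp only [opOn, Matrix.of_apply]
  by_cases h : x = flp q y
  · rw [if_pos h]
    apply Finset.prod_eq_one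
    intro j _
    subst h
    by_cases hq : j = q
    · subst hq
      rw [if_pos rfl]
      rcases fin2_cases (y j) with h | h <;> simp [h, PX, flp]
    · simp [hq, flp]
  · rw [if_neg h]
    obtain ⟨j, hj⟩ := Function.ne_iff.mp h
    apply Finset.prod_eq_zero (Finset.mem_univ j)
    by_cases hq : j = q
    · subst hq
      rw [if_pos rfl]
      rcases fin2_cases (x j) with h | h <;> rcases fin2_cases (y j) with h' | h' <;>
        simp_all [PX, flp]
    · simp_all [flp]

theorem mulX {N : ℕ} (M : Mat N) (q : Fin N) (x y) : (M * opOn PX q) x y = M x (flp q y) := by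
  rw [opX, Matrix.mul_apply]; simp

theorem Xmul {N : ℕ} (M : Mat N) (q : Fin N) (x y) : (opOn PX q * M) x y = M (flp q x) y := by
  rw [opX, Matrix.mul_apply]
  rw [Finset.sum_eq_single (flp q x)]
  · simp [flp_flp]
  · intro b _ hb
    have : x ≠ flp q b := by
      rintro rfl; exact hb (flp_flp q b).symm
    simp [this]
  · simp

theorem mulZ {N : ℕ} (M : Mat N) (q : Fin N) (x y) : (M * opOn PZ q) x y = M x y * sgn q y := by
  rw [opZ, Matrix.mul_diagonal]

theorem Zmul {N : ℕ} (M : Mat N) (q : Fin N) (x y) : (opOn PZ q * M) x y = sgn q x * M x y := by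
  rw [opZ, Matrix.diagonal_mul]

theorem XX {N : ℕ} (q : Fin N) : opOn PX q * opOn PX q = (1 : Mat N) := by
  ext x y
  rw [mulX, opX, Matrix.of_apply, flp_flp, Matrix.one_apply]

theorem ZZ {N : ℕ} (q : Fin N) : opOn PZ q * opOn PZ q = (1 : Mat N) := by
  rw [opZ, Matrix.diagonal_mul_diagonal]
  simp [sgn_sq]

theorem XH {N : ℕ} (q : Fin N) : (opOn PX q : Mat N)ᴴ = opOn PX q := by
  ext x y
  rw [opX, Matrix.conjTranspose_apply, Matrix.of_apply, Matrix.of_apply]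
  have : (y = flp q x) ↔ (x = flp q y) :=
    ⟨fun h => by rw [h, flp_flp], fun h => by rw [h, flp_flp]⟩
  simp [this, apply_ite]

theorem ZH {N : ℕ} (q : Fin N) : (opOn PZ q : Mat N)ᴴ = opOn PZ q := by
  rw [opZ, Matrix.diagonal_conjTranspose]
  congr 1; ext x; exact sgn_star q x

theorem XXc {N : ℕ} (p q : Fin N) : opOn PX p * opOn PX q = (opOn PX q * opOn PX p : Mat N) := by
  ext x y
  rw [mulX, mulX, opX, opX, Matrix.of_apply, Matrix.of_apply, flp_comm]

theorem ZZc {N : ℕ} (p q : Fin N) : opOn PZ p * opOn PZ q = (opOn PZ q * opOn PZ p : Mat N) := by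
  ext x y
  rw [opZ, opZ, Matrix.diagonal_mul_diagonal, Matrix.diagonal_mul_diagonal]
  simp only [mul_comm]

theorem XZc {N : ℕ} {p q : Fin N} (h : p ≠ q) :
    opOn PX p * opOn PZ q = (opOn PZ q * opOn PX p : Mat N) := by
  ext x y
  rw [Xmul, mulX, opZ]
  by_cases h' : flp p x = y
  · subst h'; rw [flp_flp]; simp [sgn_flp_ne h]
  · have : x ≠ flp p y := by rintro rfl; exact h' (flp_flp p y)
    rw [Matrix.diagonal_apply_ne _ h', Matrix.diagonal_apply_ne _ this]

theorem XZa {N : ℕ} (p : Fin N) :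
    opOn PX p * opOn PZ p = -(opOn PZ p * opOn PX p : Mat N) := by
  ext x y
  rw [Matrix.neg_apply, Xmul, mulX, opZ]
  by_cases h' : flp p x = y
  · subst h'; rw [flp_flp]; simp [sgn_flp_same]
  · have : x ≠ flp p y := by rintro rfl; exact h' (flp_flp p y)
    rw [Matrix.diagonal_apply_ne _ h', Matrix.diagonal_apply_ne _ this, neg_zero]

theorem scalar_of_comm {N : ℕ} (M : Mat N)
    (hX : ∀ q, M * opOn PX q = opOn PX q * M) (hZ : ∀ q, M * opOn PZ q = opOn PZ q * M) :
    ∃ c : ℂ, M = c • 1 := by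
  have hoff : ∀ x y, x ≠ y → M x y = 0 := by
    intro x y h
    obtain ⟨j, hj⟩ := Function.ne_iff.mp h
    have := congrFun (congrFun (hZ j) x) y
    rw [mulZ, Zmul] at this
    unfold sgn at this
    rcases fin2_cases (x j) with h | h <;> rcases fin2_cases (y j) with h' | h'
    · rw [h, h'] at hj; exact absurd rfl hj
    · rw [h, h'] at this; simp at this
      linear_combination (-1/2 : ℂ) * this
    · rw [h, h'] at this; simp at this
      linear_combination (1/2 : ℂ) * this
    · rw [h, h'] at hj; exact absurd rfl hj
  have hd : ∀ q x, M (flp q x) (flp q x) = M x x := by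
    intro q x
    have := congrFun (congrFun (hX q) x) (flp q x)
    rw [mulX, Xmul, flp_flp] at this
    exact this.symm
  have hs : ∀ s : Finset (Fin N), ∀ x : Fin N → Fin 2, (∀ j ∉ s, x j = 0) → M x x = M 0 0 := by
    intro s
    induction s using Finset.induction_on with
    | empty => intro x hx; have : x = 0 := by ext j; simp [hx j]
               rw [this]
    | insert a s ha ih =>
      intro x hx
      rcases fin2_cases (x a) with h | h
      · apply ih; intro j hj
        by_cases hja : j = a
        · rw [hja, h]
        · exact hx j (by simp [hja, hj])
      · rw [← hd a x]
        apply ih; intro j hj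
        by_cases hja : j = a
        · subst hja; simp [flp, h]
        · simp [flp, hja]; exact hx j (by simp [hja, hj])
  refine ⟨M 0 0, ?_⟩
  ext x y
  by_cases h : x = y
  · subst h; simp [hs Finset.univ x (by simp)]
  · simp [hoff x y h, h]

theorem I_mem {N : ℕ} : (Complex.I • (1 : Mat N)) ∈ PauliGroup N :=
  Submonoid.subset_closure (Or.inl (Or.inl rfl))

theorem X_mem {N : ℕ} (q : Fin N) : (opOn PX q : Mat N) ∈ PauliGroup N :=
  Submonoid.subset_closure (Or.inl (Or.inr ⟨q, rfl⟩))

theorem Z_mem {N : ℕ} (q : Fin N) : (opOn PZ q : Mat N) ∈ PauliGroup N :=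
  Submonoid.subset_closure (Or.inr ⟨q, rfl⟩)

theorem neg_one_mem' {N : ℕ} : (-1 : Mat N) ∈ PauliGroup N := by
  have := (PauliGroup N).mul_mem (I_mem (N := N)) I_mem
  simpa [smul_smul] using this

theorem neg_mem' {N : ℕ} {P : Mat N} (h : P ∈ PauliGroup N) : -P ∈ PauliGroup N := by
  have := (PauliGroup N).mul_mem neg_one_mem' h
  simpa using this

def CA {N : ℕ} (P Q : Mat N) : Prop := P * Q = Q * P ∨ P * Q = -(Q * P)

theorem CA.symm {N : ℕ} {P Q : Mat N} (h : CA P Q) : CA Q P := by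
  rcases h with h | h
  · exact Or.inl h.symm
  · exact Or.inr (by rw [h, neg_neg])

theorem cc {N : ℕ} {P Q R : Mat N} (h : P * R = R * P) (h' : Q * R = R * Q) :
    P * Q * R = R * (P * Q) := by rw [mul_assoc, h', ← mul_assoc, h, mul_assoc]
theorem ca {N : ℕ} {P Q R : Mat N} (h : P * R = R * P) (h' : Q * R = -(R * Q)) :
    P * Q * R = -(R * (P * Q)) := by
  rw [mul_assoc, h', mul_neg, ← mul_assoc, h, mul_assoc]
theorem ac {N : ℕ} {P Q R : Mat N} (h : P * R = -(R * P)) (h' : Q * R = R * Q) :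
    P * Q * R = -(R * (P * Q)) := by
  rw [mul_assoc, h', ← mul_assoc, h, neg_mul, mul_assoc]
theorem aa {N : ℕ} {P Q R : Mat N} (h : P * R = -(R * P)) (h' : Q * R = -(R * Q)) :
    P * Q * R = R * (P * Q) := by
  rw [mul_assoc, h', mul_neg, ← mul_assoc, h, neg_mul, mul_assoc, neg_neg]

theorem CA.mul {N : ℕ} {P Q R : Mat N} (h : CA P R) (h' : CA Q R) : CA (P * Q) R := by
  rcases h with h | h <;> rcases h' with h' | h'
  · exact Or.inl (cc h h')
  · exact Or.inr (ca h h')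
  · exact Or.inr (ac h h')
  · exact Or.inl (aa h h')

theorem CA_gen {N : ℕ} {P : Mat N} (hP : P ∈ PauliGroup N) (R : Mat N)
    (hX : ∀ q, CA (opOn PX q) R) (hZ : ∀ q, CA (opOn PZ q) R) : CA P R := by
  unfold PauliGroup at hP
  induction hP using Submonoid.closure_induction with
  | mem x hx =>
    rcases hx with (hx | ⟨q, rfl⟩) | ⟨q, rfl⟩
    · rw [Set.mem_singleton_iff] at hx; subst hx; left; simp
    · exact hX q
    · exact hZ q
  | one => left; simp
  | mul x y _ _ h h' => exact h.mul h'

theorem pauli_CA {N : ℕ} {P Q : Mat N} (hP : P ∈ PauliGroup N) (hQ : Q ∈ PauliGroup N) :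
    CA P Q := by
  refine CA_gen hP Q (fun q => (CA_gen hQ _ ?_ ?_).symm) (fun q => (CA_gen hQ _ ?_ ?_).symm)
  · intro p; exact Or.inl (XXc p q)
  · intro p
    by_cases h : q = p
    · subst h; exact CA.symm (Or.inr (XZa q))
    · exact CA.symm (Or.inl (XZc h))
  · intro p
    by_cases h : p = q
    · subst h; exact (Or.inr (XZa p))
    · exact (Or.inl (XZc h))
  · intro p; exact Or.inl (ZZc p q)

theorem pauli_sq {N : ℕ} {P : Mat N} (hP : P ∈ PauliGroup N) : P * P = 1 ∨ P * P = -1 := by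
  have hP' := hP
  unfold PauliGroup at hP'
  induction hP' using Submonoid.closure_induction with
  | mem x hx =>
    rcases hx with (hx | ⟨q, rfl⟩) | ⟨q, rfl⟩
    · rw [Set.mem_singleton_iff] at hx; subst hx; right; simp [smul_smul]
    · exact Or.inl (XX q)
    · exact Or.inl (ZZ q)
  | one => left; simp
  | mul x y hx hy h h' =>
    have hc : x * y * (x * y) = x * (y * x) * y := by noncomm_ring
    have hd : x * (x * y) * y = (x * x) * (y * y) := by noncomm_ring
    rw [hc]
    rcases pauli_CA hy hx with h1 | h1 <;> rcases h hx with h2 | h2 <;>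
      rcases h' hy with h3 | h3 <;> simp [h1, hd, h2, h3]

theorem pauli_unit {N : ℕ} {P : Mat N} (hP : P ∈ PauliGroup N) : Pᴴ * P = 1 := by
  unfold PauliGroup at hP
  induction hP using Submonoid.closure_induction with
  | mem x hx =>
    rcases hx with (hx | ⟨q, rfl⟩) | ⟨q, rfl⟩
    · rw [Set.mem_singleton_iff] at hx; subst hx; simp [smul_smul]
    · simp only [XH, XX]
    · simp only [ZH, ZZ]
  | one => simp
  | mul x y _ _ h h' =>
    rw [Matrix.conjTranspose_mul, mul_assoc, ← mul_assoc xᴴ, h, one_mul, h']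

theorem pauli_herm {N : ℕ} {P : Mat N} (hP : P ∈ PauliGroup N) (h : P * P = 1) : Pᴴ = P := by
  have := pauli_unit hP
  calc Pᴴ = Pᴴ * (P * P) := by rw [h, mul_one]
    _ = P := by rw [← mul_assoc, this, one_mul]

structure Cliff {N : ℕ} (W : Mat N) : Prop where
  u1 : W * Wᴴ = 1
  u2 : Wᴴ * W = 1
  p : ∀ P ∈ PauliGroup N, W * P * Wᴴ ∈ PauliGroup N

theorem Cliff.one {N : ℕ} : Cliff (1 : Mat N) := ⟨by simp, by simp, by simp⟩

theorem Cliff.mul {N : ℕ} {V W : Mat N} (hV : Cliff V) (hW : Cliff W) : Cliff (V * W) := by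
  refine ⟨?_, ?_, ?_⟩
  · rw [Matrix.conjTranspose_mul, mul_assoc, ← mul_assoc W, hW.u1, one_mul, hV.u1]
  · rw [Matrix.conjTranspose_mul, mul_assoc, ← mul_assoc Vᴴ, hV.u2, one_mul, hW.u2]
  · intro P hP
    have := hV.p _ (hW.p P hP)
    rw [Matrix.conjTranspose_mul]
    simpa only [mul_assoc] using this

theorem swap {N : ℕ} {P Q : Mat N} (hP : P ∈ PauliGroup N) (hQ : Q ∈ PauliGroup N)
    (hPP : P * P = 1) (hQQ : Q * Q = 1) (hPQ : P * Q = -(Q * P)) :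
    ∃ W : Mat N, Cliff W ∧ W * P * Wᴴ = Q ∧
      ∀ M, M * P = P * M → M * Q = Q * M → W * M * Wᴴ = M := by
  obtain ⟨r, hr, hr2⟩ : ∃ r : ℂ, star r = r ∧ r * r = 1/2 := by
    refine ⟨((Real.sqrt (1/2) : ℝ) : ℂ), Complex.conj_ofReal _, ?_⟩
    rw [← Complex.ofReal_mul, Real.mul_self_sqrt (by norm_num)]; norm_num
  have hH : (r • (P + Q))ᴴ = r • (P + Q) := by
    rw [Matrix.conjTranspose_smul, Matrix.conjTranspose_add, pauli_herm hP hPP,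
      pauli_herm hQ hQQ, hr]
  have hQP : Q * P = -(P * Q) := by rw [hPQ, neg_neg]
  have hex : ∀ M : Mat N, r • (P + Q) * M * (r • (P + Q)) =
      (1/2 : ℂ) • ((P + Q) * M * (P + Q)) := by
    intro M; rw [smul_mul_assoc, smul_mul_assoc, mul_smul_comm, smul_smul, hr2]
  have hsq : (P + Q) * (P + Q) = (2 : ℂ) • 1 := by
    rw [add_mul, mul_add, mul_add, hPP, hQQ, hQP, two_smul]; abel
  have hdiff : (P - Q) * (P + Q) = (2 : ℂ) • (P * Q) := by
    rw [sub_mul, mul_add, mul_add, hPP, hQQ, hQP, two_smul]; abel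
  have hcomm : ∀ M, M * P = P * M → M * Q = Q * M →
      r • (P + Q) * M * (r • (P + Q)) = M := by
    intro M h1 h2
    rw [hex, show (P + Q) * M = M * (P + Q) by rw [add_mul, mul_add, h1, h2], mul_assoc, hsq]
    simp
  have hu : r • (P + Q) * (r • (P + Q)) = 1 := by
    have := hcomm 1 (by simp) (by simp)
    simpa using this
  refine ⟨r • (P + Q), ⟨?_, ?_, ?_⟩, ?_, ?_⟩
  · rw [hH, hu]
  · rw [hH, hu]
  · intro R hR
    rw [hH]
    rcases pauli_CA hR hP with h1 | h1 <;> rcases pauli_CA hR hQ with h2 | h2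
    · rw [hcomm R h1 h2]; exact hR
    · have : (P + Q) * R = R * (P - Q) := by rw [add_mul, mul_sub, h1, h2]; abel
      rw [hex, this, mul_assoc, hdiff, mul_smul_comm, smul_smul]
      norm_num
      exact mul_mem hR (mul_mem hP hQ)
    · have : (P + Q) * R = -(R * (P - Q)) := by rw [add_mul, mul_sub, h1, h2]; abel
      rw [hex, this, neg_mul, mul_assoc, hdiff, mul_smul_comm, smul_neg, smul_smul]
      norm_num
      exact neg_mem' (mul_mem hR (mul_mem hP hQ))
    · have : (P + Q) * R = -(R * (P + Q)) := by rw [add_mul, mul_add, h1, h2]; abel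
      rw [hex, this, neg_mul, mul_assoc, hsq, mul_smul_comm, smul_neg, smul_smul]
      norm_num
      exact neg_mem' hR
  · rw [hH, hex, add_mul, hPP, add_mul, mul_add, hQP, neg_mul, mul_assoc P Q, mul_add Q, hQQ, hQP]
    rw [mul_add, mul_neg, ← mul_assoc P P, hPP]
    simp only [one_mul, mul_one]
    rw [show P + Q + -(-Q + P) = (2 : ℂ) • Q by rw [two_smul]; abel, smul_smul]
    norm_num
  · intro M h1 h2; rw [hH]; exact hcomm M h1 h2

def CZ (N k : ℕ) : Submonoid (Mat N) :=
  Submonoid.closure {M : Mat N | ∃ j : Fin N, (j : ℕ) < k ∧ M = opOn PZ j}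

theorem CZ_comm {N k : ℕ} {M R : Mat N} (hM : M ∈ CZ N k)
    (hR : ∀ j : Fin N, (j : ℕ) < k → opOn PZ j * R = R * opOn PZ j) : M * R = R * M := by
  unfold CZ at hM
  induction hM using Submonoid.closure_induction with
  | mem x hx => obtain ⟨j, hj, rfl⟩ := hx; exact hR j hj
  | one => simp
  | mul x y _ _ h h' => exact cc h h'

theorem Z_mem_CZ {N k : ℕ} (j : Fin N) (h : (j : ℕ) < k) : (opOn PZ j : Mat N) ∈ CZ N k :=
  Submonoid.subset_closure ⟨j, h, rfl⟩

theorem CZ_le {N k : ℕ} {G : Submonoid (Mat N)}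
    (h : ∀ j : Fin N, (j : ℕ) < k → (opOn PZ j : Mat N) ∈ G) : CZ N k ≤ G := by
  unfold CZ; rw [Submonoid.closure_le]
  rintro _ ⟨j, hj, rfl⟩; exact h j hj

theorem CZ_succ {N k : ℕ} (hk : k < N) :
    (CZ N (k+1) : Set (Mat N)) = (CZ N k : Set (Mat N)) ∪
      (fun M => opOn PZ ⟨k, hk⟩ * M) '' (CZ N k : Set (Mat N)) := by
  have hmono : CZ N k ≤ CZ N (k+1) := CZ_le fun j hj => Z_mem_CZ j (by omega)
  have hc : ∀ M ∈ CZ N k, M * opOn PZ ⟨k, hk⟩ = opOn PZ ⟨k, hk⟩ * M :=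
    fun M hM => CZ_comm hM (fun j _ => ZZc _ _)
  apply Set.Subset.antisymm
  · intro M hM
    have hM' : M ∈ CZ N (k+1) := hM
    unfold CZ at hM'
    induction hM' using Submonoid.closure_induction with
    | mem x hx =>
      obtain ⟨j, hj, rfl⟩ := hx
      by_cases h : (j : ℕ) < k
      · exact Or.inl (Z_mem_CZ j h)
      · have : j = ⟨k, hk⟩ := Fin.ext (by simp; omega)
        subst this
        exact Or.inr ⟨1, one_mem _, by simp⟩
    | one => exact Or.inl (one_mem _)
    | mul x y hx hy h h' =>
      rcases h hx with h | ⟨a, ha, rfl⟩ <;> rcases h' hy with h' | ⟨b, hb, rfl⟩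
      · exact Or.inl (mul_mem (S := Submonoid (Mat N)) h h')
      · refine Or.inr ⟨x * b, mul_mem (S := Submonoid (Mat N)) h hb, ?_⟩
        simp only; rw [← mul_assoc, ← hc x h, mul_assoc]
      · exact Or.inr ⟨a * y, mul_mem (S := Submonoid (Mat N)) ha h', by simp only [mul_assoc]⟩
      · refine Or.inl ?_
        have : opOn PZ ⟨k, hk⟩ * a * (opOn PZ ⟨k, hk⟩ * b) = a * b := by
          rw [← hc a ha, mul_assoc, ← mul_assoc (opOn PZ _), ZZ, one_mul]
        simp only [this]
        exact mul_mem (S := Submonoid (Mat N)) ha hb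
  · rintro M (hM | ⟨a, ha, rfl⟩)
    · exact hmono hM
    · exact mul_mem (S := Submonoid (Mat N)) (Z_mem_CZ _ (by simp)) (hmono ha)

theorem pauli_ne_zero {N : ℕ} {P : Mat N} (hP : P ∈ PauliGroup N) : P ≠ 0 := by
  rintro rfl
  have := pauli_unit hP
  simp at this

theorem CZ_le_pauli {N k : ℕ} : CZ N k ≤ PauliGroup N := CZ_le fun j _ => Z_mem j

theorem ne_of_anti {N : ℕ} {P R : Mat N} (hP : P ∈ PauliGroup N) (hR : R ∈ PauliGroup N)
    (h1 : P * R = R * P) (h2 : P * R = -(R * P)) : False := by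
  have h0 : R * P ≠ 0 := pauli_ne_zero (mul_mem hR hP)
  apply h0
  have h3 := h1.symm.trans h2
  ext x y
  have h4 : (R * P) x y = -((R * P) x y) := congrFun (congrFun h3 x) y
  exact self_eq_neg.mp h4

theorem CZ_card {N k : ℕ} (hk : k ≤ N) :
    (CZ N k : Set (Mat N)).Finite ∧ (CZ N k : Set (Mat N)).ncard = 2 ^ k := by
  induction k with
  | zero =>
    have : CZ N 0 = ⊥ := by unfold CZ; simp
    rw [this]; simp
  | succ k ih =>
    obtain ⟨hf, hc⟩ := ih (by omega)
    rw [CZ_succ (by omega : k < N)]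
    refine ⟨hf.union (hf.image _), ?_⟩
    rw [Set.ncard_union_eq ?_ hf (hf.image _), Set.ncard_image_of_injective, hc]
    · ring
    · intro a b h
      have := congrArg (fun M => opOn PZ (⟨k, hk⟩ : Fin N) * M) h
      simpa [← mul_assoc, ZZ] using this
    · rw [Set.disjoint_left]
      rintro M hM ⟨a, ha, rfl⟩
      have hx : ∀ M ∈ CZ N k, M * opOn PX ⟨k, hk⟩ = opOn PX ⟨k, hk⟩ * M := fun M hM =>
        CZ_comm hM fun j hj => (XZc (by intro h; rw [← h] at hj; simp at hj)).symm
      have h1 := hx _ hM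
      have h2 := hx a ha
      exact ne_of_anti (CZ_le_pauli hM) (X_mem _) h1 (ac (by rw [XZa, neg_neg]) h2)

/-- an element of a stabilizer group commuting with enough Paulis is in `CZ`. -/
theorem mem_CZ_of_comm {N k : ℕ} {G : Submonoid (Mat N)} (hGP : G ≤ PauliGroup N)
    (hneg : (-1 : Mat N) ∉ G) (hCZ : CZ N k ≤ G) {g : Mat N} (hg : g ∈ G)
    (hZ : ∀ q, g * opOn PZ q = opOn PZ q * g)
    (hX : ∀ q : Fin N, k ≤ (q : ℕ) → g * opOn PX q = opOn PX q * g) : g ∈ CZ N k := by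
  have key : ∀ s : Finset (Fin N), ∃ z ∈ CZ N k,
      ∀ q : Fin N, (q ∈ s ∨ k ≤ (q : ℕ)) → z * g * opOn PX q = opOn PX q * (z * g) := by
    intro s
    induction s using Finset.induction_on with
    | empty => exact ⟨1, one_mem _, fun q hq => by simpa using hX q (by simpa using hq)⟩
    | insert a s ha ih =>
      obtain ⟨z, hz, h⟩ := ih
      have hzg : z * g ∈ PauliGroup N := mul_mem (CZ_le_pauli hz) (hGP hg)
      rcases pauli_CA hzg (X_mem a) with h1 | h1
      · refine ⟨z, hz, ?_⟩
        intro q hq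
        by_cases hqa : q = a
        · rw [hqa]; exact h1
        · exact h q (by simpa [hqa] using hq)
      · have hak : (a : ℕ) < k := by
          by_contra hcon
          exact ne_of_anti hzg (X_mem a) (h a (Or.inr (by omega))) h1
        refine ⟨opOn PZ a * z, mul_mem (Z_mem_CZ a hak) hz, ?_⟩
        intro q hq
        rw [mul_assoc (opOn PZ a)]
        by_cases hqa : q = a
        · subst hqa
          exact aa (by rw [XZa, neg_neg]) h1
        · exact cc (XZc hqa).symm (h q (by simpa [hqa] using hq))
  obtain ⟨z, hz, h⟩ := key Finset.univ
  have hzZ : ∀ q, z * opOn PZ q = opOn PZ q * z := fun q => CZ_comm hz fun j _ => ZZc _ _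
  obtain ⟨c, hc⟩ := scalar_of_comm (z * g) (fun q => h q (by simp)) (fun q => cc (hzZ q) (hZ q))
  have hzgG : z * g ∈ G := mul_mem (hCZ hz) hg
  have hsq : z * g * (z * g) = 1 := by
    rcases pauli_sq (hGP hzgG) with h | h
    · exact h
    · exact absurd (h ▸ mul_mem hzgG hzgG) hneg
  have hone : z * g = 1 := by
    have hcc : c * c = 1 := by
      rw [hc] at hsq
      have := congrFun (congrFun hsq 0) 0
      simpa using this
    rcases mul_self_eq_one_iff.mp hcc with h | h
    · rw [hc, h, one_smul]
    · rw [h, neg_one_smul] at hc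
      exact absurd (hc ▸ hzgG) hneg
  have hzz : z * z = 1 := by
    rcases pauli_sq (hGP (hCZ hz)) with h | h
    · exact h
    · exact absurd (h ▸ mul_mem (hCZ hz) (hCZ hz)) hneg
  have : g = z := by
    calc g = z * z * g := by rw [hzz, one_mul]
      _ = z := by rw [mul_assoc, hone, mul_one]
  rw [this]; exact hz

theorem step {N k : ℕ} (hk : k < N) {G : Submonoid (Mat N)} (hGP : G ≤ PauliGroup N)
    (hcomm : ∀ a ∈ G, ∀ b ∈ G, a * b = b * a)
    (hneg : (-1 : Mat N) ∉ G) (hCZ : CZ N k ≤ G) {g : Mat N} (hg : g ∈ G) (hgn : g ∉ CZ N k) :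
    ∃ W : Mat N, Cliff W ∧ W * g * Wᴴ = opOn PZ ⟨k, hk⟩ ∧
      ∀ j : Fin N, (j : ℕ) < k → W * opOn PZ j * Wᴴ = opOn PZ j := by
  have hgP := hGP hg
  have hgg : g * g = 1 := by
    rcases pauli_sq hgP with h | h
    · exact h
    · exact absurd (h ▸ mul_mem hg hg) hneg
  have hgZ : ∀ j : Fin N, (j : ℕ) < k → opOn PZ j * g = g * opOn PZ j := fun j hj =>
    hcomm _ (hCZ (Z_mem_CZ j hj)) _ hg
  set t : Fin N := ⟨k, hk⟩ with ht
  have hne : ∀ j : Fin N, (j : ℕ) < k → t ≠ j := by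
    rintro j hj rfl; simp [ht] at hj
  rcases pauli_CA hgP (Z_mem t) with hgt | hgt
  swap
  · obtain ⟨W, hW, h1, h2⟩ := swap hgP (Z_mem t) hgg (ZZ t) hgt
    exact ⟨W, hW, h1, fun j hj => h2 _ (hgZ j hj) (ZZc _ _)⟩
  -- find h
  obtain ⟨h, hh, hhh, hhg, hht, hhZ⟩ : ∃ h ∈ PauliGroup N, h * h = 1 ∧ g * h = -(h * g) ∧
      h * opOn PZ t = -(opOn PZ t * h) ∧
      ∀ j : Fin N, (j : ℕ) < k → opOn PZ j * h = h * opOn PZ j := by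
    rcases pauli_CA hgP (X_mem t) with hgx | hgx
    swap
    · exact ⟨_, X_mem t, XX t, hgx, XZa t, fun j hj => (XZc (hne j hj)).symm⟩
    have main : ∀ Q ∈ PauliGroup N, Q * Q = 1 → g * Q = -(Q * g) →
        Q * opOn PX t = opOn PX t * Q → Q * opOn PZ t = opOn PZ t * Q →
        (∀ j : Fin N, (j : ℕ) < k → Q * opOn PZ j = opOn PZ j * Q) →
        ∃ h ∈ PauliGroup N, h * h = 1 ∧ g * h = -(h * g) ∧
          h * opOn PZ t = -(opOn PZ t * h) ∧
          ∀ j : Fin N, (j : ℕ) < k → opOn PZ j * h = h * opOn PZ j := by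
      intro Q hQ hQQ hgQ hQX hQt hQZ
      refine ⟨opOn PX t * Q, mul_mem (X_mem t) hQ, ?_, ?_, ?_, ?_⟩
      · rw [mul_assoc, ← mul_assoc Q, hQX, mul_assoc, hQQ, mul_one, XX]
      · have := ca (P := opOn PX t) (Q := Q) (R := g) hgx.symm (by rw [hgQ, neg_neg])
        rw [this, neg_neg]
      · exact ac (XZa t) hQt
      · intro j hj; exact (cc (XZc (hne j hj)) (hQZ j hj)).symm
    by_contra hcon
    apply hgn
    refine mem_CZ_of_comm hGP hneg hCZ hg ?_ ?_
    · intro q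
      rcases lt_trichotomy (q : ℕ) k with hq | hq | hq
      · exact (hgZ q hq).symm
      · have : q = t := Fin.ext hq
        rw [this]; exact hgt
      · rcases pauli_CA hgP (Z_mem q) with h | h
        · exact h
        · have hqt : t ≠ q := by rintro rfl; simp [ht] at hq
          exact absurd (main _ (Z_mem q) (ZZ q) h (XZc hqt).symm (ZZc _ _)
            (fun j _ => ZZc _ _)) hcon
    · intro q hq
      rcases hq.eq_or_lt with hq | hq
      · have : q = t := Fin.ext hq.symm
        rw [this]; exact hgx
      · rcases pauli_CA hgP (X_mem q) with h | h
        · exact h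
        · have hqt : q ≠ t := by rintro rfl; simp [ht] at hq
          refine absurd (main _ (X_mem q) (XX q) h (XXc _ _) (XZc hqt) ?_) hcon
          intro j hj
          exact XZc (by rintro rfl; omega)
  obtain ⟨W, hW, h1, h2⟩ := swap hgP hh hgg hhh hhg
  obtain ⟨V, hV, h3, h4⟩ := swap hh (Z_mem t) hhh (ZZ t) hht
  refine ⟨V * W, hV.mul hW, ?_, ?_⟩
  · rw [Matrix.conjTranspose_mul, ← h3, ← h1]; simp only [mul_assoc]
  · intro j hj
    have e1 := h2 _ (hgZ j hj) (hhZ j hj)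
    have e2 := h4 _ (hhZ j hj) (ZZc j t)
    rw [Matrix.conjTranspose_mul]
    calc V * W * opOn PZ j * (Wᴴ * Vᴴ) = V * (W * opOn PZ j * Wᴴ) * Vᴴ := by
          simp only [mul_assoc]
      _ = _ := by rw [e1, e2]

def conj {N : ℕ} (W : Mat N) (h : W * Wᴴ = 1) (h' : Wᴴ * W = 1) : Mat N →* Mat N where
  toFun M := W * M * Wᴴ
  map_one' := by rw [mul_one, h]
  map_mul' a b := by
    symm
    calc W * a * Wᴴ * (W * b * Wᴴ) = W * a * (Wᴴ * W) * b * Wᴴ := by simp only [mul_assoc]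
      _ = _ := by rw [h']; simp only [mul_assoc, one_mul]

theorem conj_inj {N : ℕ} {W : Mat N} (h' : Wᴴ * W = 1) :
    Function.Injective (fun M : Mat N => W * M * Wᴴ) := by
  intro a b hab
  have := congrArg (fun M => Wᴴ * M * W) hab
  have e : ∀ M : Mat N, Wᴴ * (W * M * Wᴴ) * W = M := by
    intro M
    calc Wᴴ * (W * M * Wᴴ) * W = (Wᴴ * W) * M * (Wᴴ * W) := by simp only [mul_assoc]
      _ = M := by rw [h', one_mul, mul_one]
  simpa only [e] using this

theorem main_ind {N S : ℕ} (hSN : S ≤ N) (d : ℕ) : ∀ k, k + d = S → ∀ G : Submonoid (Mat N),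
    G ≤ PauliGroup N → (∀ a ∈ G, ∀ b ∈ G, a * b = b * a) → (-1 : Mat N) ∉ G →
    (G : Set (Mat N)).ncard = 2 ^ S → CZ N k ≤ G →
    ∃ W : Mat N, Cliff W ∧
      (fun M => W * M * Wᴴ) '' (G : Set (Mat N)) = (CZ N S : Set (Mat N)) := by
  induction d with
  | zero =>
    intro k hk G _ _ _ hcard hle
    have hk : k = S := by omega
    subst hk
    refine ⟨1, Cliff.one, ?_⟩
    have hfin : (G : Set (Mat N)).Finite := Set.finite_of_ncard_ne_zero (by rw [hcard]; positivity)
    have := Set.eq_of_subset_of_ncard_le (s := (CZ N k : Set (Mat N))) (t := (G : Set (Mat N))) hle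
      (by rw [hcard, (CZ_card hSN).2]) hfin
    rw [this]; simp
  | succ d ih =>
    intro k hk G hGP hcomm hneg hcard hle
    obtain ⟨g, hg, hgn⟩ : ∃ g ∈ (G : Set (Mat N)), g ∉ (CZ N k : Set (Mat N)) := by
      apply Set.exists_mem_notMem_of_ncard_lt_ncard
      · rw [hcard, (CZ_card (by omega)).2]
        exact Nat.pow_lt_pow_right (by norm_num) (by omega)
      · exact (CZ_card (by omega)).1
    obtain ⟨V, hV, h1, h2⟩ := step (by omega : k < N) hGP hcomm hneg hle hg hgn
    have hinj := conj_inj hV.u2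
    have key := ih (k+1) (by omega) (G.map (conj V hV.u1 hV.u2))
    apply Exists.elim (key ?_ ?_ ?_ ?_ ?_)
    · rintro W ⟨hW, h3⟩
      refine ⟨W * V, hW.mul hV, ?_⟩
      rw [← h3, Submonoid.coe_map, Set.image_image]
      apply Set.image_congr
      intro a _
      simp only [conj, MonoidHom.coe_mk, OneHom.coe_mk, Matrix.conjTranspose_mul, mul_assoc]
    · rintro _ ⟨a, ha, rfl⟩
      exact hV.p a (hGP ha)
    · rintro _ ⟨a, ha, rfl⟩ _ ⟨b, hb, rfl⟩
      rw [← map_mul, ← map_mul, hcomm a ha b hb]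
    · rintro ⟨a, ha, hab⟩
      apply hneg
      have : a = -1 := hinj (by
        change V * a * Vᴴ = -1 at hab
        simp only [hab, mul_neg, mul_one, neg_mul, hV.u1])
      rw [← this]; exact ha
    · rw [Submonoid.coe_map, ← hcard]
      exact Set.ncard_image_of_injective _ hinj
    · apply CZ_le
      intro j hj
      by_cases hjk : (j : ℕ) < k
      · exact ⟨opOn PZ j, hle (Z_mem_CZ j hjk), h2 j hjk⟩
      · have : j = ⟨k, by omega⟩ := Fin.ext (by simp; omega)
        rw [this]
        exact ⟨g, hg, h1⟩

theorem stabilizer_group_to_canonical_form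
    (N S : ℕ) (hN : 0 < N) (hSN : S ≤ N)
    (G : Submonoid (Matrix (Fin N → Fin 2) (Fin N → Fin 2) ℂ))
    (hGP : G ≤ PauliGroup N)
    (hGcomm : ∀ a ∈ G, ∀ b ∈ G, a * b = b * a)
    (hGneg : (-1 : Matrix (Fin N → Fin 2) (Fin N → Fin 2) ℂ) ∉ G)
    (hGcard : Nat.card G = 2 ^ S) :
    ∃ W : Matrix (Fin N → Fin 2) (Fin N → Fin 2) ℂ,
      W * Wᴴ = 1 ∧ Wᴴ * W = 1 ∧
      (∀ P ∈ PauliGroup N, W * P * Wᴴ ∈ PauliGroup N) ∧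
      (fun M => W * M * Wᴴ) '' (G : Set (Matrix (Fin N → Fin 2) (Fin N → Fin 2) ℂ)) =
        ↑(Submonoid.closure
          {M : Matrix (Fin N → Fin 2) (Fin N → Fin 2) ℂ |
            ∃ j : Fin N, (j : ℕ) < S ∧ M = opOn PZ j}) := by
  obtain ⟨W, hW, h⟩ := main_ind hSN S 0 (by omega) G hGP hGcomm hGneg
    (by rw [← hGcard]; rfl) (CZ_le (by intro j hj; omega))
  exact ⟨W, hW.u1, hW.u2, hW.p, h⟩

end Z2LGT
end
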